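/- Let n be a positive integer and let 𝒜ₙ be a nonempty bridge-alterable set of simple graphs on vertex set {1,…,n}. Then |{G ∈ 𝒜ₙ : G is connected}| / |𝒜ₙ| ≥ min over integers t with 0.48·n < t ≤ n of |𝒯ₜ| / |ℱₜ|. -/

import Mathlib

/-- A set of simple graphs on a fixed vertex set is bridge-alterable if for every
graph `G` and every bridge `e` of `G`, `G` is in the set iff `G - e` is. -/
def BridgeAlterable {n : ℕ} (A : Set (SimpleGraph (Fin n))) : Prop :=
  ∀ (G : SimpleGraph (Fin n)) (e : Sym2 (Fin n)), G.IsBridge e →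
    (G ∈ A ↔ G.deleteEdges {e} ∈ A)

/-- The number of trees on vertex set `{1,…,t}`. -/
noncomputable def treeCount (t : ℕ) : ℕ :=
  {T : SimpleGraph (Fin t) | T.IsTree}.ncard

/-- The number of forests on vertex set `{1,…,t}`. -/
noncomputable def forestCount (t : ℕ) : ℕ :=
  {F : SimpleGraph (Fin t) | F.IsAcyclic}.ncard

/-- The sum of `f x y r` over all ordered pairs `x, y` of distinct entries of the multiset `s`,
where `r` consists of the remaining entries. -/
def Multiset.pairSum {α : Type*} [DecidableEq α] (f : α → α → Multiset α → ℝ)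
    (s : Multiset α) : ℝ :=
  (s.map fun x => ((s.erase x).map fun y => f x y ((s.erase x).erase y)).sum).sum

namespace Multiset

section PairSum

variable {α : Type*} [DecidableEq α]

lemma pairSum_cons (f : α → α → Multiset α → ℝ) (x : α) (t : Multiset α) :
    pairSum f (x ::ₘ t) = (t.map fun y => f x y (t.erase y) + f y x (t.erase y)).sum +
      pairSum (fun y z r => f y z (x ::ₘ r)) t := by
  have h : t.map (fun y => (((x ::ₘ t).erase y).map
        fun z => f y z (((x ::ₘ t).erase y).erase z)).sum) =
      t.map (fun y => f y x (t.erase y) +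
        ((t.erase y).map fun z => f y z (x ::ₘ (t.erase y).erase z)).sum) := by
    refine map_congr rfl fun y hy => ?_
    rw [erase_cons_tail_of_mem hy, map_cons, sum_cons, erase_cons_head]
    congr 2
    exact map_congr rfl fun z hz => by rw [erase_cons_tail_of_mem hz]
  simp only [pairSum]
  rw [map_cons, sum_cons, h]
  simp only [sum_map_add, erase_cons_head]
  ring

lemma pairSum_congr {f g : α → α → Multiset α → ℝ} {s : Multiset α}
    (h : ∀ x ∈ s, ∀ y ∈ s.erase x,
      f x y ((s.erase x).erase y) = g x y ((s.erase x).erase y)) :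
    pairSum f s = pairSum g s :=
  congrArg sum (map_congr rfl fun x hx =>
    congrArg sum (map_congr rfl fun y hy => h x hx y hy))

lemma pairSum_le_pairSum {f g : α → α → Multiset α → ℝ} {s : Multiset α}
    (h : ∀ x ∈ s, ∀ y ∈ s.erase x,
      f x y ((s.erase x).erase y) ≤ g x y ((s.erase x).erase y)) :
    pairSum f s ≤ pairSum g s :=
  sum_map_le_sum_map _ _ fun x hx => sum_map_le_sum_map _ _ fun y hy => h x hx y hy

lemma pairSum_nonneg {f : α → α → Multiset α → ℝ} {s : Multiset α}
    (h : ∀ x ∈ s, ∀ y ∈ s.erase x, 0 ≤ f x y ((s.erase x).erase y)) :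
    0 ≤ pairSum f s := by
  refine sum_nonneg fun a ha => ?_
  obtain ⟨x, hx, rfl⟩ := mem_map.1 ha
  refine sum_nonneg fun b hb => ?_
  obtain ⟨y, hy, rfl⟩ := mem_map.1 hb
  exact h x hx y hy

lemma pairSum_add (f g : α → α → Multiset α → ℝ) (s : Multiset α) :
    pairSum (fun x y r => f x y r + g x y r) s = pairSum f s + pairSum g s := by
  simp [pairSum, sum_map_add]

lemma pairSum_mul_left (c : ℝ) (f : α → α → Multiset α → ℝ) (s : Multiset α) :
    pairSum (fun x y r => c * f x y r) s = c * pairSum f s := by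
  simp [pairSum, sum_map_mul_left]

lemma pairSum_swap (f : α → α → Multiset α → ℝ) (s : Multiset α) :
    pairSum (fun x y r => f y x r) s = pairSum f s := by
  induction s using Multiset.induction generalizing f with
  | empty => simp [pairSum]
  | cons x t ih =>
    rw [pairSum_cons, pairSum_cons, ih fun y z r => f y z (x ::ₘ r)]
    simp only [add_comm]

/-- A sum over ordered triples of distinct entries may start with the first or the last entry. -/
lemma sum_map_pairSum_erase (g : α → α → α → Multiset α → ℝ) (s : Multiset α) :
    (s.map fun x => pairSum (g x) (s.erase x)).sum =
      pairSum (fun y z r => (r.map fun x => g x y z (r.erase x)).sum) s := by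
  have h := pairSum_swap (fun x y r => (r.map fun z => g x y z (r.erase z)).sum) s
  calc (s.map fun x => pairSum (g x) (s.erase x)).sum
      = pairSum (fun x y r => (r.map fun z => g x y z (r.erase z)).sum) s := rfl
    _ = pairSum (fun y x r => (r.map fun z => g x y z (r.erase z)).sum) s := h.symm
    _ = (s.map fun y => pairSum (fun x z r => g x y z r) (s.erase y)).sum := rfl
    _ = (s.map fun y => pairSum (fun z x r => g x y z r) (s.erase y)).sum := by
        refine congrArg sum (map_congr rfl fun y _ => ?_)
        exact (pairSum_swap (fun x z r => g x y z r) (s.erase y)).symm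
    _ = _ := rfl

end PairSum

lemma pairSum_map_val {β : Type*} [DecidableEq β] (f : ℝ → ℝ → Multiset ℝ → ℝ)
    (P : Finset β) (w : β → ℝ) :
    pairSum f (P.val.map w) = ∑ X ∈ P, ∑ Y ∈ P.erase X,
      f (w X) (w Y) (((P.erase X).erase Y).val.map w) := by
  rw [pairSum, map_map]
  refine congrArg sum (map_congr rfl fun X hX => ?_)
  rw [Function.comp_apply, ← map_erase_of_mem w _ hX, ← Finset.erase_val, map_map]
  refine congrArg sum (map_congr rfl fun Y hY => ?_)
  rw [Function.comp_apply, ← map_erase_of_mem w _ hY, ← Finset.erase_val]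

/-- For positive weights `s`, this is the ratio between the total weight of the spanning forests
with `s.card - d` components and that of the spanning trees of the complete graph on `s`, where an
edge `xy` has weight `x * y`. -/
noncomputable def forestRatio : ℕ → Multiset ℝ → ℝ
  | 0, s => s.sum ^ 2 / (s.prod * s.sum ^ s.card)
  | d + 1, s => (2 * (d + 1) * s.sum)⁻¹ *
      pairSum (fun x y r => (x + y) * forestRatio d ((x + y) ::ₘ r)) s

lemma mul_forestRatio_succ (d : ℕ) {s : Multiset ℝ} (hs : 0 < s.sum) :
    2 * (d + 1) * s.sum * forestRatio (d + 1) s =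
      pairSum (fun x y r => (x + y) * forestRatio d ((x + y) ::ₘ r)) s := by
  rw [forestRatio, mul_inv_cancel_left₀]
  positivity

lemma forall_mem_merge {s : Multiset ℝ} (hs : ∀ x ∈ s, 0 < x) {x y : ℝ} (hx : x ∈ s)
    (hy : y ∈ s.erase x) : ∀ z ∈ (x + y) ::ₘ (s.erase x).erase y, 0 < z := by
  intro z hz
  rcases mem_cons.1 hz with rfl | hz
  · exact add_pos (hs x hx) (hs y (mem_of_mem_erase hy))
  · exact hs z (mem_of_mem_erase (mem_of_mem_erase hz))

lemma sum_merge {s : Multiset ℝ} {x y : ℝ} (hx : x ∈ s) (hy : y ∈ s.erase x) :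
    ((x + y) ::ₘ (s.erase x).erase y).sum = s.sum := by
  rw [sum_cons, add_assoc, sum_erase hy, sum_erase hx]

lemma sum_pos_of_forall_pos {s : Multiset ℝ} (hs : ∀ x ∈ s, 0 < x) (h : s ≠ 0) : 0 < s.sum := by
  obtain ⟨x, hx⟩ := exists_mem_of_ne_zero h
  rw [← sum_erase hx]
  exact add_pos_of_pos_of_nonneg (hs x hx)
    (sum_nonneg fun y hy => (hs y (mem_of_mem_erase hy)).le)

lemma forestRatio_nonneg (d : ℕ) {s : Multiset ℝ} (hs : ∀ x ∈ s, 0 < x) :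
    0 ≤ forestRatio d s := by
  have hsum : 0 ≤ s.sum := sum_nonneg fun x hx => (hs x hx).le
  induction d generalizing s with
  | zero =>
    have : 0 ≤ s.prod := prod_nonneg fun x hx => (hs x hx).le
    rw [forestRatio]; positivity
  | succ d ih =>
    rw [forestRatio]
    refine mul_nonneg (by positivity) (pairSum_nonneg fun x hx y hy => ?_)
    refine mul_nonneg (add_pos (hs x hx) (hs y (mem_of_mem_erase hy))).le ?_
    exact ih (forall_mem_merge hs hx hy) (by rwa [sum_merge hx hy])

lemma pairSum_add_entries (s : Multiset ℝ) :
    pairSum (fun x y _ => x + y) s = 2 * (s.card - 1) * s.sum := by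
  induction s using Multiset.induction with
  | empty => simp [pairSum]
  | cons x t ih =>
    rw [pairSum_cons, ih]
    have h : (t.map fun y => x + y + (y + x)) = t.map fun y => 2 * x + 2 * y :=
      map_congr rfl fun y _ => by ring
    rw [h, sum_map_add, sum_map_mul_left (f := fun y => y)]
    simp only [map_const', sum_replicate, map_id', card_cons, sum_cons, nsmul_eq_mul]
    push_cast
    ring

lemma forestRatio_of_card_eq (d : ℕ) {s : Multiset ℝ} (hs : ∀ x ∈ s, 0 < x)
    (hd : s.card = d + 1) : forestRatio d s = 1 := by
  induction d generalizing s with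
  | zero =>
    obtain ⟨x, rfl⟩ := card_eq_one.1 hd
    have : x ≠ 0 := (hs x (mem_singleton_self x)).ne'
    simp [forestRatio]
    field_simp
  | succ d ih =>
    have hpos : 0 < s.sum := sum_pos_of_forall_pos hs (by rintro rfl; simp at hd)
    rw [forestRatio, pairSum_congr (g := fun x y _ => x + y), pairSum_add_entries, hd]
    · push_cast
      field_simp
      ring
    · intro x hx y hy
      rw [ih (forall_mem_merge hs hx hy), mul_one]
      rw [card_cons, card_erase_of_mem hy, card_erase_of_mem hx, hd]
      rfl

/-- For two entries with a given sum, the ratio is affine in the inverse of their product. -/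
lemma exists_forestRatio_cons_cons (d : ℕ) (t : Multiset ℝ) (ht : ∀ x ∈ t, 0 < x) (σ : ℝ)
    (hσ : 0 < σ) : ∃ K D : ℝ, 0 ≤ D ∧ ∀ x y : ℝ, 0 < x → 0 < y → x + y = σ →
      forestRatio d (x ::ₘ y ::ₘ t) = K + D / (x * y) := by
  induction d generalizing t σ with
  | zero =>
    have h1 : 0 ≤ t.sum := sum_nonneg fun x hx => (ht x hx).le
    have h2 : 0 < t.prod := prod_pos ht
    refine ⟨0, (σ + t.sum) ^ 2 / (t.prod * (σ + t.sum) ^ (t.card + 2)), by positivity, ?_⟩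
    rintro x y hx hy rfl
    simp only [forestRatio, sum_cons, prod_cons, card_cons, ← add_assoc]
    have : 0 < x + y + t.sum := by positivity
    field_simp
    ring
  | succ d ih =>
    choose! K D hD h using ih
    have ht' : ∀ z ∈ t, ∀ y ∈ t.erase z, 0 < y := fun z _ y hy => ht y (mem_of_mem_erase hy)
    have h1 : 0 ≤ t.sum := sum_nonneg fun x hx => (ht x hx).le
    refine ⟨(2 * (d + 1) * (σ + t.sum))⁻¹ * (2 * σ * forestRatio d (σ ::ₘ t) +
        (t.map fun z => 2 * (σ + 2 * z) * K (t.erase z) (σ + z)).sum +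
        pairSum (fun z w r => (z + w) * K ((z + w) ::ₘ r) σ) t),
      (2 * (d + 1) * (σ + t.sum))⁻¹ * ((t.map fun z => 2 * σ * D (t.erase z) (σ + z)).sum +
        pairSum (fun z w r => (z + w) * D ((z + w) ::ₘ r) σ) t), ?_, ?_⟩
    · refine mul_nonneg (by positivity) (add_nonneg (sum_nonneg fun a ha => ?_)
        (pairSum_nonneg fun z hz w hw => ?_))
      · obtain ⟨z, hz, rfl⟩ := mem_map.1 ha
        have := hD _ (ht' z hz) _ (add_pos hσ (ht z hz))
        positivity
      · have := hD _ (forall_mem_merge ht hz hw) _ hσ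
        have := ht z hz
        have := ht' z hz w hw
        positivity
    · rintro x y hx hy rfl
      have e1 : t.map (fun z => (x + z) * forestRatio d ((x + z) ::ₘ y ::ₘ t.erase z) +
            (z + x) * forestRatio d ((z + x) ::ₘ y ::ₘ t.erase z) +
            ((y + z) * forestRatio d ((y + z) ::ₘ x ::ₘ t.erase z) +
            (z + y) * forestRatio d ((z + y) ::ₘ x ::ₘ t.erase z))) =
          t.map (fun z => 2 * (x + y + 2 * z) * K (t.erase z) (x + y + z) +
            (x * y)⁻¹ * (2 * (x + y) * D (t.erase z) (x + y + z))) := by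
        refine map_congr rfl fun z hz => ?_
        have hz0 := ht z hz
        rw [add_comm z x, add_comm z y,
          h _ (ht' z hz) (x + y + z) (by positivity) (x + z) y (by positivity) hy (by ring),
          h _ (ht' z hz) (x + y + z) (by positivity) (y + z) x (by positivity) hx (by ring)]
        field_simp
        ring
      have e2 : pairSum (fun z w r => (z + w) * forestRatio d ((z + w) ::ₘ x ::ₘ y ::ₘ r)) t =
          pairSum (fun z w r => (z + w) * K ((z + w) ::ₘ r) (x + y) +
            (x * y)⁻¹ * ((z + w) * D ((z + w) ::ₘ r) (x + y))) t := by
        refine pairSum_congr fun z hz w hw => ?_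
        rw [cons_swap (z + w) x, cons_swap (z + w) y,
          h _ (forall_mem_merge ht hz hw) (x + y) hσ x y hx hy rfl]
        field_simp
      rw [pairSum_add, pairSum_mul_left] at e2
      replace e1 := congrArg sum e1
      simp only [sum_map_add, sum_map_mul_left] at e1
      rw [forestRatio, pairSum_cons, pairSum_cons, map_cons, sum_cons, erase_cons_head, e2]
      have e3 : t.map (fun z => (x + z) * forestRatio d ((x + z) ::ₘ (y ::ₘ t).erase z) +
            (z + x) * forestRatio d ((z + x) ::ₘ (y ::ₘ t).erase z)) =
          t.map (fun z => (x + z) * forestRatio d ((x + z) ::ₘ y ::ₘ t.erase z) +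
            (z + x) * forestRatio d ((z + x) ::ₘ y ::ₘ t.erase z)) :=
        map_congr rfl fun z hz => by rw [erase_cons_tail_of_mem hz]
      rw [e3]
      simp only [sum_map_add, sum_map_mul_left, sum_cons, add_comm y x] at e1 ⊢
      rw [← add_assoc x y t.sum, div_eq_inv_mul]
      linear_combination (2 * (d + 1) * (x + y + t.sum))⁻¹ * e1

lemma forestRatio_spread (d : ℕ) {t : Multiset ℝ} (ht : ∀ x ∈ t, 0 < x) {x y : ℝ}
    (hx : 1 ≤ x) (hy : 1 ≤ y) :
    forestRatio d (x ::ₘ y ::ₘ t) ≤ forestRatio d ((x + y - 1) ::ₘ 1 ::ₘ t) := by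
  obtain ⟨K, D, hD, h⟩ := exists_forestRatio_cons_cons d t ht (x + y) (by linarith)
  rw [h x y (by linarith) (by linarith) rfl,
    h (x + y - 1) 1 (by linarith) one_pos (by ring)]
  have : (x + y - 1) * 1 ≤ x * y := by nlinarith
  have : 0 < (x + y - 1) * 1 := by linarith
  gcongr

lemma mul_forestRatio_succ_cons (d : ℕ) {x : ℝ} {t : Multiset ℝ} (hx : 0 < x)
    (ht : ∀ y ∈ t, 0 < y) :
    2 * (d + 1) * (x + t.sum) * forestRatio (d + 1) (x ::ₘ t) =
      (t.map fun y => 2 * (x + y) * forestRatio d ((x + y) ::ₘ t.erase y)).sum +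
        pairSum (fun y z r => (y + z) * forestRatio d (x ::ₘ (y + z) ::ₘ r)) t := by
  have hsum : 0 < (x ::ₘ t).sum := by
    rw [sum_cons]
    exact add_pos_of_pos_of_nonneg hx (sum_nonneg fun y hy => (ht y hy).le)
  rw [← sum_cons, mul_forestRatio_succ d hsum, pairSum_cons]
  congr 1
  · refine congrArg sum (map_congr rfl fun y _ => ?_)
    rw [add_comm y x]
    ring
  · exact pairSum_congr fun y _ z _ => by rw [cons_swap]

/-- Merging one entry with another one chosen with probability proportional to its size decreases
the ratio on average. -/
lemma sum_forestRatio_merge_le (d : ℕ) {x : ℝ} {t : Multiset ℝ} (hx : 0 < x)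
    (ht : ∀ y ∈ t, 0 < y) :
    (t.map fun y => y * forestRatio d ((x + y) ::ₘ t.erase y)).sum ≤
      t.sum * forestRatio (d + 1) (x ::ₘ t) := by
  induction d generalizing x t with
  | zero =>
    have hsum : 0 ≤ t.sum := sum_nonneg fun y hy => (ht y hy).le
    have hrec := mul_forestRatio_succ_cons 0 hx ht
    have hpair : 0 ≤ pairSum (fun y z r => (y + z) * forestRatio 0 (x ::ₘ (y + z) ::ₘ r)) t := by
      refine pairSum_nonneg fun y hy z hz => mul_nonneg
        (add_pos (ht y hy) (ht z (mem_of_mem_erase hz))).le (forestRatio_nonneg _ fun w hw => ?_)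
      rcases mem_cons.1 hw with rfl | hw
      · exact hx
      · exact forall_mem_merge ht hy hz w hw
    have hle : (t.map fun y => 2 * (x + t.sum) * (y * forestRatio 0 ((x + y) ::ₘ t.erase y))).sum ≤
        (t.map fun y => t.sum * (2 * (x + y) * forestRatio 0 ((x + y) ::ₘ t.erase y))).sum := by
      refine sum_map_le_sum_map _ _ fun y hy => ?_
      have hy0 := ht y hy
      have hpos : ∀ z ∈ t.erase y, 0 < z := fun z hz => ht z (mem_of_mem_erase hz)
      have hyt : 0 ≤ t.sum - y := by
        rw [← sum_erase hy, add_sub_cancel_left]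
        exact sum_nonneg fun z hz => (hpos z hz).le
      have hr : 0 ≤ forestRatio 0 ((x + y) ::ₘ t.erase y) := by
        refine forestRatio_nonneg _ fun z hz => ?_
        rcases mem_cons.1 hz with rfl | hz
        exacts [by positivity, hpos z hz]
      nlinarith [mul_nonneg (mul_nonneg hx.le hyt) hr]
    rw [sum_map_mul_left, sum_map_mul_left] at hle
    have h2 : 0 < 2 * (x + t.sum) := by positivity
    refine le_of_mul_le_mul_left ?_ h2
    push_cast at hrec
    nlinarith [mul_nonneg hsum hpair]
  | succ d ih =>
    have hsum : 0 ≤ t.sum := sum_nonneg fun y hy => (ht y hy).le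
    have hpos : ∀ y, ∀ z ∈ t.erase y, 0 < z := fun y z hz => ht z (mem_of_mem_erase hz)
    set A : ℝ → ℝ := fun y => forestRatio (d + 1) ((x + y) ::ₘ t.erase y) with hA
    set G : ℝ → ℝ → Multiset ℝ → ℝ := fun y z r => forestRatio d ((x + y + z) ::ₘ r) with hG
    set B : ℝ → ℝ → Multiset ℝ → ℝ :=
      fun y z r => (r.map fun w =>
        w * ((y + z) * forestRatio d ((x + w) ::ₘ (y + z) ::ₘ r.erase w))).sum
      with hB
    set C : ℝ → ℝ → Multiset ℝ → ℝ :=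
      fun y z r => (y + z) * forestRatio (d + 1) (x ::ₘ (y + z) ::ₘ r) with hC
    have hrec := mul_forestRatio_succ_cons (d + 1) hx ht
    have hswap : pairSum (fun y z r => y * G y z r) t = pairSum (fun y z r => z * G y z r) t := by
      rw [← pairSum_swap]
      exact pairSum_congr fun y _ z _ => by simp only [hG, add_right_comm]
    have hswap' : pairSum (fun y z r => 2 * y * (x + y + z) * G y z r) t =
        pairSum (fun y z r => (y + z) * ((y + z) * G y z r)) t +
          2 * x * pairSum (fun y z r => z * G y z r) t := by
      have h := pairSum_swap (fun y z r => y * (x + y + z) * G y z r) t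
      have h' : pairSum (fun y z r => z * (x + z + y) * G z y r) t =
          pairSum (fun y z r => z * (x + y + z) * G y z r) t :=
        pairSum_congr fun y _ z _ => by simp only [hG, add_right_comm x z y]
      rw [two_mul, add_mul]
      nth_rewrite 1 [← hswap]
      rw [← pairSum_mul_left, ← pairSum_mul_left, ← pairSum_add, ← pairSum_add]
      calc _ = pairSum (fun y z r => y * (x + y + z) * G y z r) t +
            pairSum (fun y z r => y * (x + y + z) * G y z r) t := by
            rw [← pairSum_add]
            exact pairSum_congr fun y _ z _ => by ring
        _ = pairSum (fun y z r => y * (x + y + z) * G y z r) t +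
            pairSum (fun y z r => z * (x + y + z) * G y z r) t := by rw [← h', h]
        _ = _ := by
            rw [← pairSum_add]
            exact pairSum_congr fun y _ z _ => by ring
    have hsumA : 2 * (d + 1) * (x + t.sum) * (t.map fun y => y * A y).sum =
        pairSum (fun y z r => 2 * y * (x + y + z) * G y z r) t + pairSum B t := by
      have htriple := sum_map_pairSum_erase
        (fun w y z r => w * ((y + z) * forestRatio d ((x + w) ::ₘ (y + z) ::ₘ r))) t
      rw [hB, ← htriple, pairSum, ← sum_map_add, ← sum_map_mul_left]
      refine congrArg sum (map_congr rfl fun y hy => ?_)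
      have h := mul_forestRatio_succ_cons d (add_pos hx (ht y hy)) (hpos y)
      rw [add_assoc x y, sum_erase hy] at h
      rw [pairSum_mul_left, mul_left_comm, hA]
      dsimp only
      rw [h, mul_add, ← sum_map_mul_left]
      congr 2
      exact map_congr rfl fun z _ => by ring
    have hGA : pairSum (fun y z r => z * G y z r) t ≤ (t.map fun y => (t.sum - y) * A y).sum := by
      refine sum_map_le_sum_map _ _ fun y hy => ?_
      have h := ih (add_pos hx (ht y hy)) (hpos y)
      rwa [eq_sub_of_add_eq' (sum_erase hy)] at h
    have hBC : pairSum (fun y z r => (y + z) * ((y + z) * G y z r)) t + pairSum B t ≤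
        t.sum * pairSum C t := by
      rw [← pairSum_add, ← pairSum_mul_left]
      refine pairSum_le_pairSum fun y hy z hz => ?_
      have h := ih hx (forall_mem_merge ht hy hz)
      rw [sum_merge hy hz, map_cons, sum_cons, erase_cons_head] at h
      have hyz : 0 ≤ y + z := (add_pos (ht y hy) (hpos y z hz)).le
      have e : ((t.erase y).erase z).map (fun w => w * forestRatio d
            ((x + w) ::ₘ ((y + z) ::ₘ (t.erase y).erase z).erase w)) =
          ((t.erase y).erase z).map (fun w => w * forestRatio d
            ((x + w) ::ₘ (y + z) ::ₘ ((t.erase y).erase z).erase w)) :=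
        map_congr rfl fun w hw => by rw [erase_cons_tail_of_mem hw]
      rw [e, ← add_assoc] at h
      have h' := mul_le_mul_of_nonneg_left h hyz
      rw [mul_add, ← sum_map_mul_left] at h'
      simp only [hB, hC, hG]
      convert! h' using 1
      · congr 2
        exact map_congr rfl fun w _ => by ring
      · ring
    have hlin : 2 * x * (t.map fun y => (t.sum - y) * A y).sum +
        2 * (x + t.sum) * (t.map fun y => y * A y).sum =
        t.sum * (t.map fun y => 2 * (x + y) * A y).sum := by
      rw [← sum_map_mul_left, ← sum_map_mul_left, ← sum_map_mul_left, ← sum_map_add]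
      exact congrArg sum (map_congr rfl fun y _ => by ring)
    have hpos' : 0 < 2 * ((d + 1 : ℕ) + 1) * (x + t.sum) := by positivity
    refine le_of_mul_le_mul_left ?_ hpos'
    rw [mul_left_comm, hrec]
    have h2x := mul_le_mul_of_nonneg_left hGA (by positivity : 0 ≤ 2 * x)
    push_cast
    linarith

lemma forestRatio_le_cons_replicate (d m : ℕ) {x : ℝ} {t : Multiset ℝ} (hx : 1 ≤ x)
    (ht : ∀ y ∈ t, 1 ≤ y) :
    forestRatio d (x ::ₘ (t + replicate m 1)) ≤
      forestRatio d ((x + t.sum - t.card) ::ₘ replicate (m + t.card) 1) := by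
  induction t using Multiset.induction generalizing x m with
  | empty => simp
  | cons y t ih =>
    have hy := ht y (mem_cons_self y t)
    have ht' : ∀ z ∈ t, 1 ≤ z := fun z hz => ht z (mem_cons_of_mem hz)
    have hpos : ∀ z ∈ t + replicate m (1 : ℝ), 0 < z := fun z hz => by
      rcases mem_add.1 hz with hz | hz
      · linarith [ht' z hz]
      · rw [eq_of_mem_replicate hz]; exact one_pos
    rw [cons_add]
    refine (forestRatio_spread d hpos hx hy).trans ?_
    have h := ih (m + 1) (by linarith : 1 ≤ x + y - 1) ht'
    rw [replicate_succ, add_cons] at h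
    convert! h using 3
    · rw [sum_cons, card_cons]; push_cast; ring
    · rw [card_cons]; congr 1; ring

lemma forestRatio_cons_replicate_le (d m j : ℕ) :
    forestRatio d (((j : ℝ) + 1) ::ₘ replicate m 1) ≤
      forestRatio (d + j) (replicate (m + j + 1) 1) := by
  induction j generalizing d m with
  | zero => simp [replicate_succ]
  | succ j ih =>
    have h := sum_forestRatio_merge_le d (x := (j : ℝ) + 1) (t := replicate (m + 1) 1)
      (by positivity) fun y hy => by rw [eq_of_mem_replicate hy]; exact one_pos
    rw [map_replicate, sum_replicate, sum_replicate, replicate_succ, erase_cons_head,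
      ← replicate_succ] at h
    simp only [nsmul_eq_mul, one_mul, mul_one] at h
    have h' := le_of_mul_le_mul_left h (by positivity)
    have h'' := ih (d + 1) (m + 1)
    push_cast
    rw [show d + (j + 1) = d + 1 + j by ring, show m + (j + 1) + 1 = m + 1 + j + 1 by ring]
    exact h'.trans h''

/-- For given total weight, the ratio is largest when all weights are equal to one. -/
lemma forestRatio_le_replicate_one (d n : ℕ) {s : Multiset ℝ} (hs : ∀ x ∈ s, 1 ≤ x)
    (h0 : s ≠ 0) (hsum : s.sum = n) (hcard : s.card ≤ n) :
    forestRatio d s ≤ forestRatio (d + (n - s.card)) (replicate n 1) := by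
  obtain ⟨x, hx⟩ := exists_mem_of_ne_zero h0
  obtain ⟨t, rfl⟩ := exists_cons_of_mem hx
  have h := forestRatio_le_cons_replicate d 0 (hs x hx) fun y hy => hs y (mem_cons_of_mem hy)
  rw [sum_cons] at hsum
  rw [card_cons] at hcard ⊢
  obtain ⟨j, rfl⟩ := Nat.exists_eq_add_of_le' hcard
  rw [hsum, replicate_zero, add_zero] at h
  refine h.trans ?_
  have h' := forestRatio_cons_replicate_le d t.card j
  push_cast
  rw [Nat.add_sub_cancel]
  convert! h' using 2
  · congr 2 <;> ring
  · congr 1; ring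

end Multiset

namespace SimpleGraph

open Finset

open scoped Classical in
/-- The vertex set of the connected component of `u`. -/
noncomputable def componentSet {V : Type*} [Fintype V] (G : SimpleGraph V) (u : V) : Finset V :=
  univ.filter (G.Reachable u)

open scoped Classical in
/-- The vertex sets of the connected components. -/
noncomputable def componentSets {V : Type*} [Fintype V] (G : SimpleGraph V) : Finset (Finset V) :=
  univ.image G.componentSet

/-- The orders of the connected components. -/
noncomputable def componentSizes {V : Type*} [Fintype V] (G : SimpleGraph V) : Multiset ℝ :=
  G.componentSets.val.map fun X => (X.card : ℝ)

/-- The number of edges plus the number of connected components. It does not change when a bridge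
is added or removed. -/
noncomputable def edgesAddComponents {V : Type*} [Fintype V] (G : SimpleGraph V) : ℕ :=
  G.edgeSet.ncard + G.componentSets.card

open scoped Classical in
/-- The graphs with `c` components which arise from `H` by adding bridges. -/
noncomputable def bridgeExtensions {V : Type*} [Fintype V] (c : ℕ) (H : SimpleGraph V) :
    Finset (SimpleGraph V) :=
  univ.filter fun G => H ≤ G ∧ G.edgesAddComponents = H.edgesAddComponents ∧
    G.componentSets.card = c

lemma sup_edge_le_iff {V : Type*} {G H : SimpleGraph V} {u v : V} (hne : u ≠ v) :
    H ⊔ edge u v ≤ G ↔ H ≤ G ∧ G.Adj u v := by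
  rw [sup_le_iff, edge_le_iff]
  simp [hne]

lemma reachable_sup_edge_iff {V : Type*} {G : SimpleGraph V} {u v a b : V} :
    (G ⊔ edge u v).Reachable a b ↔ G.Reachable a b ∨
      (G.Reachable a u ∧ G.Reachable v b) ∨ (G.Reachable a v ∧ G.Reachable u b) := by
  have huv : (G ⊔ edge u v).Reachable u v := by
    by_cases h : u = v
    · rw [h]
    · exact Adj.reachable (by simp [edge_adj, h])
  have hle : ∀ {a b}, G.Reachable a b → (G ⊔ edge u v).Reachable a b :=
    fun h => h.mono le_sup_left
  constructor
  · rintro ⟨p⟩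
    induction p with
    | nil => exact Or.inl (Reachable.refl _)
    | cons h p ih =>
      rw [sup_adj, edge_adj] at h
      rcases h with h | ⟨⟨rfl, rfl⟩ | ⟨rfl, rfl⟩, -⟩
      · have := h.reachable
        exact ih.imp this.trans (Or.imp (fun h => ⟨this.trans h.1, h.2⟩)
          (fun h => ⟨this.trans h.1, h.2⟩))
      · rcases ih with h | h | h
        · exact Or.inr (Or.inl ⟨Reachable.refl _, h⟩)
        · exact Or.inr (Or.inl ⟨Reachable.refl _, h.2⟩)
        · exact Or.inl h.2
      · rcases ih with h | h | h
        · exact Or.inr (Or.inr ⟨Reachable.refl _, h⟩)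
        · exact Or.inl h.2
        · exact Or.inr (Or.inr ⟨Reachable.refl _, h.2⟩)
  · rintro (h | h | h)
    · exact hle h
    · exact ((hle h.1).trans huv).trans (hle h.2)
    · exact ((hle h.1).trans huv.symm).trans (hle h.2)

variable {V : Type*} [Fintype V] {G H : SimpleGraph V} {u v : V}

@[simp]
lemma mem_componentSet : v ∈ G.componentSet u ↔ G.Reachable u v := by
  simp [componentSet]

lemma componentSet_eq_iff : G.componentSet u = G.componentSet v ↔ G.Reachable u v := by
  refine ⟨fun h => ?_, fun h => ?_⟩
  · rw [← mem_componentSet, h, mem_componentSet]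
  · ext w
    simp only [mem_componentSet]
    exact ⟨h.symm.trans, h.trans⟩

lemma componentSet_mem_componentSets (u : V) : G.componentSet u ∈ G.componentSets := by
  simp [componentSets]

lemma mem_componentSets {X : Finset V} : X ∈ G.componentSets ↔ ∃ u, G.componentSet u = X := by
  simp [componentSets]

lemma componentSet_eq_of_mem {X : Finset V} (hX : X ∈ G.componentSets) :
    G.componentSet u = X ↔ u ∈ X := by
  obtain ⟨w, rfl⟩ := mem_componentSets.1 hX
  rw [componentSet_eq_iff, mem_componentSet, reachable_comm]

lemma one_le_of_mem_componentSizes {x : ℝ} (hx : x ∈ G.componentSizes) : 1 ≤ x := by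
  obtain ⟨X, hX, rfl⟩ := Multiset.mem_map.1 hx
  obtain ⟨u, rfl⟩ := mem_componentSets.1 hX
  have : 0 < (G.componentSet u).card := card_pos.2 ⟨u, by simp⟩
  exact_mod_cast this

lemma card_componentSizes : G.componentSizes.card = G.componentSets.card := by
  simp [componentSizes]

open scoped Classical in
lemma sum_componentSet (f : Finset V → ℝ) :
    ∑ u, f (G.componentSet u) = ∑ X ∈ G.componentSets, (X.card : ℝ) * f X := by
  rw [sum_comp f G.componentSet]
  refine sum_congr rfl fun X hX => ?_
  rw [nsmul_eq_mul]
  congr 3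
  ext u
  simp [componentSet_eq_of_mem hX]

lemma sum_componentSizes : G.componentSizes.sum = Fintype.card V := by
  have h := G.sum_componentSet fun _ => 1
  simp only [mul_one, sum_const, nsmul_eq_mul, card_univ] at h
  rw [h]
  rfl

lemma card_componentSets_le : G.componentSets.card ≤ Fintype.card V := by
  classical
  exact card_image_le

lemma card_componentSets_pos [Nonempty V] : 0 < G.componentSets.card :=
  card_pos.2 ⟨_, componentSet_mem_componentSets (Classical.arbitrary V)⟩

lemma connected_iff_card_componentSets [Nonempty V] :
    G.Connected ↔ G.componentSets.card = 1 := by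
  rw [connected_iff, card_eq_one]
  refine ⟨fun h => ⟨G.componentSet (Classical.arbitrary V), ?_⟩, ?_⟩
  · ext X
    rw [mem_componentSets, mem_singleton]
    refine ⟨?_, fun h => ⟨_, h.symm⟩⟩
    rintro ⟨u, rfl⟩
    exact componentSet_eq_iff.2 (h.1 _ _)
  · rintro ⟨X, hX⟩
    refine ⟨fun u v => componentSet_eq_iff.1 ?_, inferInstance⟩
    have hu := G.componentSet_mem_componentSets u
    have hv := G.componentSet_mem_componentSets v
    rw [hX, mem_singleton] at hu hv
    rw [hu, hv]

lemma componentSets_sup_edge_of_reachable (h : G.Reachable u v) :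
    (G ⊔ edge u v).componentSets = G.componentSets := by
  have : (G ⊔ edge u v).componentSet = G.componentSet := by
    ext a b
    simp only [mem_componentSet, reachable_sup_edge_iff]
    refine ⟨?_, Or.inl⟩
    rintro (h' | h' | h')
    · exact h'
    · exact (h'.1.trans h).trans h'.2
    · exact (h'.1.trans h.symm).trans h'.2
  rw [componentSets, this, componentSets]

open scoped Classical in
lemma componentSets_sup_edge (u v : V) :
    (G ⊔ edge u v).componentSets = insert (G.componentSet u ∪ G.componentSet v)
      ((G.componentSets.erase (G.componentSet u)).erase (G.componentSet v)) := by
  have key : ∀ a, (G ⊔ edge u v).componentSet a =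
      if G.Reachable u a ∨ G.Reachable v a then G.componentSet u ∪ G.componentSet v
      else G.componentSet a := by
    intro a
    ext b
    have h1 := @Reachable.symm _ G
    have h2 := @Reachable.trans _ G
    split_ifs with ha
    · simp only [mem_componentSet, reachable_sup_edge_iff, mem_union]
      rcases ha with ha | ha
      · exact ⟨by grind, by grind⟩
      · exact ⟨by grind, by grind⟩
    · simp only [mem_componentSet, reachable_sup_edge_iff]
      exact ⟨by grind, by grind⟩
  ext X
  rw [mem_componentSets, mem_insert, mem_erase, mem_erase, mem_componentSets]
  constructor
  · rintro ⟨a, rfl⟩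
    rw [key]
    split_ifs with ha
    · exact Or.inl rfl
    · rw [not_or] at ha
      refine Or.inr ⟨fun h => ha.2 ?_, fun h => ha.1 ?_, a, rfl⟩
      · exact (componentSet_eq_iff.1 h).symm
      · exact (componentSet_eq_iff.1 h).symm
  · rintro (rfl | ⟨hv, hu, a, rfl⟩)
    · exact ⟨u, by rw [key, if_pos (Or.inl (Reachable.refl u))]⟩
    · refine ⟨a, ?_⟩
      rw [key, if_neg]
      rintro (ha | ha)
      · exact hu (componentSet_eq_iff.2 ha.symm)
      · exact hv (componentSet_eq_iff.2 ha.symm)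

open scoped Classical in
lemma componentSet_union_notMem (u v : V) :
    G.componentSet u ∪ G.componentSet v ∉
      (G.componentSets.erase (G.componentSet u)).erase (G.componentSet v) := by
  intro hmem
  have hX := mem_of_mem_erase (mem_of_mem_erase hmem)
  have hu := (componentSet_eq_of_mem hX).2
    (mem_union_left _ (mem_componentSet.2 (Reachable.refl u)))
  exact (mem_erase.1 (mem_of_mem_erase hmem)).1 hu.symm

open scoped Classical in
lemma componentSet_mem_erase (h : ¬ G.Reachable u v) :
    G.componentSet v ∈ G.componentSets.erase (G.componentSet u) :=
  mem_erase.2 ⟨fun h' => h (componentSet_eq_iff.1 h').symm, componentSet_mem_componentSets v⟩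

lemma card_componentSets_sup_edge (h : ¬ G.Reachable u v) :
    (G ⊔ edge u v).componentSets.card + 1 = G.componentSets.card := by
  classical
  rw [componentSets_sup_edge u v, card_insert_of_notMem (componentSet_union_notMem u v),
    card_erase_add_one (componentSet_mem_erase h),
    card_erase_add_one (componentSet_mem_componentSets u)]

open scoped Classical in
lemma componentSizes_sup_edge (h : ¬ G.Reachable u v) :
    (G ⊔ edge u v).componentSizes = ((G.componentSet u).card + (G.componentSet v).card : ℝ) ::ₘ
      ((G.componentSets.erase (G.componentSet u)).erase (G.componentSet v)).val.map
        fun X => (X.card : ℝ) := by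
  rw [componentSizes, componentSets_sup_edge u v,
    insert_val_of_notMem (componentSet_union_notMem u v), Multiset.map_cons, card_union_of_disjoint]
  · push_cast
    rfl
  · rw [Finset.disjoint_left]
    intro w hu hv
    rw [mem_componentSet] at hu hv
    exact h (hu.trans hv.symm)

open scoped Classical in
lemma sum_componentSizes_sup_edge (f : Multiset ℝ → ℝ) :
    ∑ u, ∑ v, (if G.Reachable u v then 0 else f (G ⊔ edge u v).componentSizes) =
      Multiset.pairSum (fun x y r => x * y * f ((x + y) ::ₘ r)) G.componentSizes := by
  set g : Finset V → Finset V → ℝ := fun X Y => if X = Y then 0 else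
    f ((X.card + Y.card : ℝ) ::ₘ ((G.componentSets.erase X).erase Y).val.map fun X => (X.card : ℝ))
    with hg
  have h1 : ∀ u v, (if G.Reachable u v then 0 else f (G ⊔ edge u v).componentSizes) =
      g (G.componentSet u) (G.componentSet v) := by
    intro u v
    simp only [hg, componentSet_eq_iff]
    split_ifs with h
    · rfl
    · rw [componentSizes_sup_edge h]
  simp only [h1]
  rw [componentSizes, Multiset.pairSum_map_val,
    G.sum_componentSet fun X => ∑ v, g X (G.componentSet v)]
  refine sum_congr rfl fun X hX => ?_
  rw [G.sum_componentSet (g X), ← add_sum_erase _ _ hX]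
  simp only [hg, if_true, mul_zero, zero_add, mul_sum]
  refine sum_congr rfl fun Y hY => ?_
  rw [if_neg (ne_of_mem_erase hY).symm]
  ring

lemma ncard_edgeSet_sup_edge (h : ¬ G.Adj u v) (hne : u ≠ v) :
    (G ⊔ edge u v).edgeSet.ncard = G.edgeSet.ncard + 1 := by
  rw [edgeSet_sup, edgeSet_edge_of_ne hne, Set.union_singleton,
    Set.ncard_insert_of_notMem (by simpa using h)]

lemma edgesAddComponents_sup_edge_of_not_reachable (h : ¬ G.Reachable u v) :
    (G ⊔ edge u v).edgesAddComponents = G.edgesAddComponents := by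
  have h1 : ¬ G.Adj u v := fun h' => h h'.reachable
  have h2 : u ≠ v := by rintro rfl; exact h (Reachable.refl u)
  have h3 := card_componentSets_sup_edge h
  rw [edgesAddComponents, edgesAddComponents, ncard_edgeSet_sup_edge h1 h2]
  lia

lemma edgesAddComponents_sup_edge_of_reachable (h : G.Reachable u v) (hadj : ¬ G.Adj u v)
    (hne : u ≠ v) : (G ⊔ edge u v).edgesAddComponents = G.edgesAddComponents + 1 := by
  rw [edgesAddComponents, edgesAddComponents, ncard_edgeSet_sup_edge hadj hne,
    componentSets_sup_edge_of_reachable h]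
  lia

lemma edgesAddComponents_mono (h : H ≤ G) : H.edgesAddComponents ≤ G.edgesAddComponents := by
  induction hm : (G.edgeSet \ H.edgeSet).ncard using Nat.strong_induction_on generalizing H with
  | _ m ih =>
    by_cases heq : H = G
    · rw [heq]
    obtain ⟨u, v, hG, hH⟩ : ∃ u v, G.Adj u v ∧ ¬ H.Adj u v := by
      by_contra! hcon
      exact heq (le_antisymm h fun u v => hcon u v)
    have hle : H ⊔ edge u v ≤ G := (sup_edge_le_iff hG.ne).2 ⟨h, hG⟩
    have hlt : (G.edgeSet \ (H ⊔ edge u v).edgeSet).ncard < m := by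
      rw [← hm]
      refine Set.ncard_lt_ncard ⟨Set.sdiff_subset_sdiff_right (edgeSet_mono le_sup_left), ?_⟩
      intro hsub
      have : s(u, v) ∈ G.edgeSet \ (H ⊔ edge u v).edgeSet := hsub ⟨hG, hH⟩
      exact this.2 (by simp [hG.ne])
    refine le_trans ?_ (ih _ hlt hle rfl)
    by_cases hr : H.Reachable u v
    · rw [edgesAddComponents_sup_edge_of_reachable hr hH hG.ne]
      exact Nat.le_succ _
    · rw [edgesAddComponents_sup_edge_of_not_reachable hr]

lemma not_reachable_of_adj (h : H ≤ G) (hG : G.edgesAddComponents = H.edgesAddComponents)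
    (huv : G.Adj u v) (hH : ¬ H.Adj u v) : ¬ H.Reachable u v := by
  intro hr
  have := edgesAddComponents_mono ((sup_edge_le_iff huv.ne).2 ⟨h, huv⟩)
  rw [edgesAddComponents_sup_edge_of_reachable hr hH huv.ne] at this
  lia

lemma mem_bridgeExtensions {c : ℕ} : G ∈ H.bridgeExtensions c ↔ H ≤ G ∧
    G.edgesAddComponents = H.edgesAddComponents ∧ G.componentSets.card = c := by
  simp [bridgeExtensions]

lemma mem_bridgeExtensions_sup_edge {c : ℕ} (h : ¬ H.Reachable u v) :
    G ∈ (H ⊔ edge u v).bridgeExtensions c ↔ G ∈ H.bridgeExtensions c ∧ G.Adj u v := by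
  have hne : u ≠ v := by rintro rfl; exact h (Reachable.refl u)
  rw [mem_bridgeExtensions, mem_bridgeExtensions, sup_edge_le_iff hne,
    edgesAddComponents_sup_edge_of_not_reachable h]
  tauto

open scoped Classical in
lemma sum_ite_adj (G : SimpleGraph V) :
    ∑ u, ∑ v, (if G.Adj u v then (1 : ℝ) else 0) = 2 * G.edgeSet.ncard := by
  have h := G.sum_degrees_eq_twice_card_edges
  rw [edgeFinset, ← Set.ncard_eq_toFinset_card'] at h
  have h' : (∑ u, (G.degree u : ℝ)) = 2 * G.edgeSet.ncard := by exact_mod_cast h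
  rw [← h']
  refine sum_congr rfl fun u _ => ?_
  rw [sum_boole, ← card_neighborFinset_eq_degree, neighborFinset_eq_filter]

open scoped Classical in
/-- Double counting of the pairs formed by a bridge extension and an added edge. -/
lemma sum_card_bridgeExtensions_sup_edge (c : ℕ) (H : SimpleGraph V) :
    ∑ u, ∑ v, (if H.Reachable u v then 0 else
        ((H ⊔ edge u v).bridgeExtensions c).card : ℝ) =
      2 * (H.componentSets.card - c) * (H.bridgeExtensions c).card := by
  have h1 : ∀ u v, (if H.Reachable u v then 0 else
      ((H ⊔ edge u v).bridgeExtensions c).card : ℝ) =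
      ∑ G ∈ H.bridgeExtensions c,
        ((if G.Adj u v then (1 : ℝ) else 0) - if H.Adj u v then 1 else 0) := by
    intro u v
    split_ifs with hr hadj hadj
    · refine (sum_eq_zero fun G hG => ?_).symm
      rw [mem_bridgeExtensions] at hG
      rw [if_pos (hG.1 hadj), sub_self]
    · refine (sum_eq_zero fun G hG => ?_).symm
      rw [mem_bridgeExtensions] at hG
      rw [if_neg fun h => not_reachable_of_adj hG.1 hG.2.1 h hadj hr, sub_self]
    · exact absurd hadj.reachable hr
    · simp only [sub_zero]
      rw [sum_boole]
      congr 2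
      ext G
      rw [mem_bridgeExtensions_sup_edge hr, mem_filter]
  simp only [h1]
  have h2 : ∀ u, ∑ v, ∑ G ∈ H.bridgeExtensions c,
        ((if G.Adj u v then (1 : ℝ) else 0) - if H.Adj u v then 1 else 0) =
      ∑ G ∈ H.bridgeExtensions c, ∑ v,
        ((if G.Adj u v then (1 : ℝ) else 0) - if H.Adj u v then 1 else 0) := fun u => sum_comm
  simp only [h2]
  rw [sum_comm, mul_comm _ ((H.bridgeExtensions c).card : ℝ), ← nsmul_eq_mul, ← sum_const]
  refine sum_congr rfl fun G hG => ?_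
  simp only [sum_sub_distrib, sum_ite_adj]
  obtain ⟨-, h, rfl⟩ := mem_bridgeExtensions.1 hG
  rw [edgesAddComponents, edgesAddComponents] at h
  have h' : (G.edgeSet.ncard : ℝ) + G.componentSets.card =
    H.edgeSet.ncard + H.componentSets.card := by exact_mod_cast h
  linarith

lemma eq_of_le_of_ncard_edgeSet_le (h : H ≤ G) (hcard : G.edgeSet.ncard ≤ H.edgeSet.ncard) :
    H = G :=
  edgeSet_injective (Set.eq_of_subset_of_ncard_le (edgeSet_mono h) hcard)

lemma bridgeExtensions_card_componentSets (H : SimpleGraph V) :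
    H.bridgeExtensions H.componentSets.card = {H} := by
  ext G
  rw [mem_bridgeExtensions, mem_singleton]
  refine ⟨fun ⟨h1, h2, h3⟩ => (eq_of_le_of_ncard_edgeSet_le h1 ?_).symm, ?_⟩
  · rw [edgesAddComponents, edgesAddComponents] at h2
    lia
  · rintro rfl
    exact ⟨le_rfl, rfl, rfl⟩

/-- The number of connected bridge extensions of a graph with component orders `s`. -/
noncomputable def treeWeight (s : Multiset ℝ) : ℝ :=
  s.prod * s.sum ^ s.card / s.sum ^ 2

lemma card_bridgeExtensions [Nonempty V] (c d : ℕ) (H : SimpleGraph V)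
    (h : H.componentSets.card = c + d) : ((H.bridgeExtensions c).card : ℝ) =
      treeWeight H.componentSizes * H.componentSizes.forestRatio d := by
  classical
  induction d generalizing H with
  | zero =>
    have hc : c = H.componentSets.card := by simpa using h.symm
    rw [hc, bridgeExtensions_card_componentSets, card_singleton, treeWeight, Multiset.forestRatio]
    have h1 : H.componentSizes.prod ≠ 0 :=
      (Multiset.prod_pos fun x hx => one_pos.trans_le (one_le_of_mem_componentSizes hx)).ne'
    have h2 : H.componentSizes.sum ≠ 0 := by
      rw [sum_componentSizes]
      exact_mod_cast Fintype.card_ne_zero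
    field_simp
    simp
  | succ d ih =>
    have hpos : 0 < H.componentSizes.sum := by
      rw [sum_componentSizes]
      exact_mod_cast Fintype.card_pos
    have hrec := sum_card_bridgeExtensions_sup_edge c H
    have hstep : ∀ u v, (if H.Reachable u v then 0 else
        ((H ⊔ edge u v).bridgeExtensions c).card : ℝ) =
        if H.Reachable u v then 0 else (fun s => treeWeight s * s.forestRatio d)
          (H ⊔ edge u v).componentSizes := by
      intro u v
      split_ifs with hr
      · rfl
      · refine ih _ ?_
        have := card_componentSets_sup_edge hr
        lia
    simp only [hstep] at hrec
    rw [H.sum_componentSizes_sup_edge fun s => treeWeight s * s.forestRatio d, h] at hrec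
    have hratio := Multiset.mul_forestRatio_succ d hpos
    have hmerge : Multiset.pairSum (fun x y r => x * y *
          (treeWeight ((x + y) ::ₘ r) * ((x + y) ::ₘ r).forestRatio d)) H.componentSizes =
        Multiset.pairSum (fun x y r => treeWeight H.componentSizes / H.componentSizes.sum *
          ((x + y) * ((x + y) ::ₘ r).forestRatio d)) H.componentSizes := by
      refine Multiset.pairSum_congr fun x hx y hy => ?_
      have hsum := Multiset.sum_merge hx hy
      rw [treeWeight, treeWeight, hsum, Multiset.prod_cons, Multiset.card_cons,
        Multiset.card_erase_add_one hy, ← Multiset.prod_erase hx, ← Multiset.prod_erase hy,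
        ← Multiset.card_erase_add_one hx, pow_succ H.componentSizes.sum (Multiset.card _)]
      field_simp
    rw [hmerge, Multiset.pairSum_mul_left, ← hratio] at hrec
    push_cast at hrec
    have hd : (0 : ℝ) < d + 1 := by positivity
    field_simp at hrec
    have e : (c : ℝ) + (d + 1) - c = d + 1 := by ring
    rw [e] at hrec
    apply mul_left_cancel₀ hd.ne'
    linarith

open scoped Classical in
/-- The graphs which arise from `H` by adding bridges. -/
noncomputable def allBridgeExtensions {V : Type*} [Fintype V] (H : SimpleGraph V) :
    Finset (SimpleGraph V) :=
  univ.filter fun G => H ≤ G ∧ G.edgesAddComponents = H.edgesAddComponents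

lemma mem_allBridgeExtensions : G ∈ H.allBridgeExtensions ↔
    H ≤ G ∧ G.edgesAddComponents = H.edgesAddComponents := by
  simp [allBridgeExtensions]

lemma card_allBridgeExtensions [Nonempty V] (H : SimpleGraph V) :
    H.allBridgeExtensions.card = ∑ c ∈ Icc 1 (Fintype.card V), (H.bridgeExtensions c).card := by
  classical
  rw [card_eq_sum_card_fiberwise (f := fun G => G.componentSets.card)
    (t := Icc 1 (Fintype.card V))]
  · refine sum_congr rfl fun c _ => congrArg card ?_
    ext G
    rw [mem_filter, mem_allBridgeExtensions, mem_bridgeExtensions, and_assoc]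
  · intro G _
    rw [mem_coe, mem_Icc]
    exact ⟨card_componentSets_pos, card_componentSets_le⟩

lemma componentSizes_bot :
    (⊥ : SimpleGraph V).componentSizes = Multiset.replicate (Fintype.card V) 1 := by
  have h : ∀ u : V, (⊥ : SimpleGraph V).componentSet u = {u} := by
    intro u
    ext v
    rw [mem_componentSet, reachable_bot, mem_singleton, eq_comm]
  classical
  rw [Multiset.eq_replicate, card_componentSizes]
  constructor
  · rw [componentSets, card_image_of_injective, card_univ]
    intro u v huv
    rwa [h, h, singleton_inj] at huv
  · intro x hx
    obtain ⟨X, hX, rfl⟩ := Multiset.mem_map.1 hx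
    obtain ⟨u, rfl⟩ := mem_componentSets.1 hX
    simp [h]

lemma treeWeight_componentSizes_pos [Nonempty V] (H : SimpleGraph V) :
    0 < treeWeight H.componentSizes := by
  have h1 : 0 < H.componentSizes.prod :=
    Multiset.prod_pos fun x hx => one_pos.trans_le (one_le_of_mem_componentSizes hx)
  have h2 : 0 < H.componentSizes.sum := by
    rw [sum_componentSizes]
    exact_mod_cast Fintype.card_pos
  rw [treeWeight]
  positivity

lemma card_bridgeExtensions_one [Nonempty V] (H : SimpleGraph V) :
    ((H.bridgeExtensions 1).card : ℝ) = treeWeight H.componentSizes := by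
  obtain ⟨d, hd⟩ := Nat.exists_eq_add_of_le (card_componentSets_pos (G := H))
  rw [card_bridgeExtensions 1 d H (by lia), Multiset.forestRatio_of_card_eq, mul_one]
  · exact fun x hx => one_pos.trans_le (one_le_of_mem_componentSizes hx)
  · rw [card_componentSizes]
    lia

lemma card_bridgeExtensions_le [Nonempty V] (c : ℕ) (H : SimpleGraph V) :
    ((H.bridgeExtensions c).card : ℝ) ≤ treeWeight H.componentSizes *
      (Multiset.replicate (Fintype.card V) 1).forestRatio (Fintype.card V - c) := by
  have hw := treeWeight_componentSizes_pos H
  rcases le_or_gt c H.componentSets.card with hc | hc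
  · obtain ⟨d, hd⟩ := Nat.exists_eq_add_of_le hc
    rw [card_bridgeExtensions c d H hd]
    refine mul_le_mul_of_nonneg_left ?_ hw.le
    have hle := card_componentSets_le (G := H)
    have h := Multiset.forestRatio_le_replicate_one d (Fintype.card V)
      (fun x hx => one_le_of_mem_componentSizes (G := H) hx) ?_ sum_componentSizes
      (by rwa [card_componentSizes])
    · rw [card_componentSizes] at h
      rwa [show Fintype.card V - c = d + (Fintype.card V - H.componentSets.card) by lia]
    · rw [← Multiset.card_pos, card_componentSizes]
      exact card_componentSets_pos
  · have h : H.bridgeExtensions c = ∅ := by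
      refine eq_empty_of_forall_notMem fun G hG => ?_
      rw [mem_bridgeExtensions] at hG
      have h1 := Set.ncard_le_ncard (edgeSet_mono hG.1)
      have h2 := hG.2.1
      rw [edgesAddComponents, edgesAddComponents] at h2
      lia
    rw [h, card_empty, Nat.cast_zero]
    refine mul_nonneg hw.le (Multiset.forestRatio_nonneg _ fun x hx => ?_)
    rw [Multiset.eq_of_mem_replicate hx]
    exact one_pos

lemma card_bridgeExtensions_bot [Nonempty V] {c : ℕ} (hc : c ≤ Fintype.card V) :
    (((⊥ : SimpleGraph V).bridgeExtensions c).card : ℝ) =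
      treeWeight (⊥ : SimpleGraph V).componentSizes *
        (Multiset.replicate (Fintype.card V) 1).forestRatio (Fintype.card V - c) := by
  rw [card_bridgeExtensions c (Fintype.card V - c), componentSizes_bot]
  rw [← card_componentSizes, componentSizes_bot, Multiset.card_replicate]
  lia

/-- Among the graphs arising from `H` by adding bridges, the proportion of connected ones is
smallest when `H` has no edges. -/
lemma card_bridgeExtensions_one_mul_le [Nonempty V] (H : SimpleGraph V) :
    ((⊥ : SimpleGraph V).bridgeExtensions 1).card * H.allBridgeExtensions.card ≤
      (H.bridgeExtensions 1).card * (⊥ : SimpleGraph V).allBridgeExtensions.card := by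
  have h : (((⊥ : SimpleGraph V).bridgeExtensions 1).card * H.allBridgeExtensions.card : ℝ) ≤
      (H.bridgeExtensions 1).card * (⊥ : SimpleGraph V).allBridgeExtensions.card := by
    rw [card_allBridgeExtensions, card_allBridgeExtensions]
    push_cast
    rw [card_bridgeExtensions_one, card_bridgeExtensions_one, mul_sum, mul_sum]
    refine sum_le_sum fun c hc => ?_
    rw [card_bridgeExtensions_bot (mem_Icc.1 hc).2, mul_left_comm]
    exact mul_le_mul_of_nonneg_left (card_bridgeExtensions_le c H)
      (treeWeight_componentSizes_pos _).le
  exact_mod_cast h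

lemma edgesAddComponents_deleteEdges_of_isBridge {e : Sym2 V} (h : G.IsBridge e) :
    (G.deleteEdges {e}).edgesAddComponents = G.edgesAddComponents := by
  induction e with | h u v
  by_cases hadj : G.Adj u v
  · have hsup : G.deleteEdges {s(u, v)} ⊔ edge u v = G := by
      ext a b
      have hsymm := hadj.symm
      have hne := hadj.ne
      simp only [sup_adj, deleteEdges_adj, edge_adj, Set.mem_singleton_iff, Sym2.eq_iff]
      grind
    rw [← edgesAddComponents_sup_edge_of_not_reachable (isBridge_iff.1 h), hsup]
  · rw [deleteEdges_eq_self.2]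
    simpa using hadj

lemma allBridgeExtensions_isBridge {e : Sym2 V} (hG : G ∈ H.allBridgeExtensions)
    (he : e ∈ G.edgeSet) (heH : e ∉ H.edgeSet) :
    G.IsBridge e ∧ G.deleteEdges {e} ∈ H.allBridgeExtensions := by
  induction e with | h u v
  rw [mem_allBridgeExtensions] at hG
  rw [mem_edgeSet] at he heH
  have hle : H ≤ G.deleteEdges {s(u, v)} := by
    intro a b hab
    rw [deleteEdges_adj, Set.mem_singleton_iff]
    refine ⟨hG.1 hab, fun h => heH ?_⟩
    rw [← mem_edgeSet, ← h]
    exact hab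
  have h1 := edgesAddComponents_mono hle
  have h2 := edgesAddComponents_mono (G.deleteEdges_le {s(u, v)})
  have h3 : G.edgesAddComponents = (G.deleteEdges {s(u, v)}).edgesAddComponents := by lia
  refine ⟨?_, mem_allBridgeExtensions.2 ⟨hle, by lia⟩⟩
  rw [isBridge_iff]
  exact not_reachable_of_adj (G.deleteEdges_le _) h3 he (by simp)

end SimpleGraph

open SimpleGraph

lemma BridgeAlterable.allBridgeExtensions_subset {n : ℕ} {A : Set (SimpleGraph (Fin n))}
    (hA : BridgeAlterable A) {H : SimpleGraph (Fin n)} (hH : H ∈ A) :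
    (H.allBridgeExtensions : Set (SimpleGraph (Fin n))) ⊆ A := by
  intro G hG
  induction hm : G.edgeSet.ncard using Nat.strong_induction_on generalizing G with
  | _ m ih =>
    by_cases heq : H = G
    · rwa [← heq]
    have hG' := (mem_allBridgeExtensions.1 hG).1
    obtain ⟨e, heG, heH⟩ : ∃ e ∈ G.edgeSet, e ∉ H.edgeSet := by
      by_contra! hcon
      exact heq (edgeSet_injective (Set.Subset.antisymm (edgeSet_mono hG') hcon))
    obtain ⟨hb, hdel⟩ := allBridgeExtensions_isBridge hG heG heH
    rw [hA G e hb]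
    refine ih _ ?_ hdel rfl
    rw [← hm, edgeSet_deleteEdges]
    exact Set.ncard_sdiff_singleton_lt_of_mem heG

lemma SimpleGraph.bridgeAlterable_allBridgeExtensions {n : ℕ} {H : SimpleGraph (Fin n)}
    (hH : ∀ e ∈ H.edgeSet, ¬ H.IsBridge e) :
    BridgeAlterable (H.allBridgeExtensions : Set (SimpleGraph (Fin n))) := by
  intro G e he
  rw [Finset.mem_coe, Finset.mem_coe, mem_allBridgeExtensions, mem_allBridgeExtensions,
    edgesAddComponents_deleteEdges_of_isBridge he]
  refine and_congr_left fun _ => ⟨fun h => ?_, fun h => h.trans (G.deleteEdges_le _)⟩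
  intro u v huv
  rw [deleteEdges_adj, Set.mem_singleton_iff]
  refine ⟨h huv, ?_⟩
  rintro rfl
  exact hH _ huv (he.anti h)

lemma isAcyclic_iff_mem_allBridgeExtensions {n : ℕ} {G : SimpleGraph (Fin n)} :
    G.IsAcyclic ↔ G ∈ (⊥ : SimpleGraph (Fin n)).allBridgeExtensions := by
  rw [isAcyclic_iff_forall_isBridge]
  refine ⟨fun h => ?_, fun h e he => (allBridgeExtensions_isBridge h he (by simp)).1⟩
  induction hm : G.edgeSet.ncard using Nat.strong_induction_on generalizing G with
  | _ m ih =>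
    by_cases heq : G = ⊥
    · rw [heq, mem_allBridgeExtensions]
      exact ⟨le_rfl, rfl⟩
    obtain ⟨e, he⟩ := edgeSet_nonempty.2 heq
    have hbridge := bridgeAlterable_allBridgeExtensions (H := (⊥ : SimpleGraph (Fin n))) (by simp)
    have := hbridge G e (h he)
    rw [Finset.mem_coe, Finset.mem_coe] at this
    rw [this]
    refine ih _ ?_ (fun f hf => ?_) rfl
    · rw [← hm, edgeSet_deleteEdges]
      exact Set.ncard_sdiff_singleton_lt_of_mem he
    · exact (h (edgeSet_mono (G.deleteEdges_le _) hf)).anti (G.deleteEdges_le _)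

lemma forestCount_eq (n : ℕ) :
    forestCount n = (⊥ : SimpleGraph (Fin n)).allBridgeExtensions.card := by
  rw [forestCount, ← Set.ncard_coe_finset]
  congr 1
  ext G
  exact isAcyclic_iff_mem_allBridgeExtensions

lemma mem_bridgeExtensions_one_iff {n : ℕ} [NeZero n] {G H : SimpleGraph (Fin n)} :
    G ∈ H.bridgeExtensions 1 ↔ G ∈ H.allBridgeExtensions ∧ G.Connected := by
  rw [mem_bridgeExtensions, mem_allBridgeExtensions, connected_iff_card_componentSets, and_assoc]

lemma treeCount_eq (n : ℕ) [NeZero n] :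
    treeCount n = ((⊥ : SimpleGraph (Fin n)).bridgeExtensions 1).card := by
  rw [treeCount, ← Set.ncard_coe_finset]
  congr 1
  ext G
  rw [Set.mem_ofPred_eq, isTree_iff, isAcyclic_iff_mem_allBridgeExtensions, Finset.mem_coe,
    mem_bridgeExtensions_one_iff, and_comm]

/-- A bridge-alterable set of graphs contains at least the same proportion of connected graphs as
the set of forests. -/
lemma BridgeAlterable.treeCount_mul_ncard_le {n : ℕ} [NeZero n] {A : Set (SimpleGraph (Fin n))}
    (hA : BridgeAlterable A) :
    treeCount n * A.ncard ≤ {G ∈ A | G.Connected}.ncard * forestCount n := by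
  induction hm : A.ncard using Nat.strong_induction_on generalizing A with
  | _ m ih =>
    rcases A.eq_empty_or_nonempty with rfl | hne
    · simp [← hm]
    obtain ⟨H, hH, hmin⟩ := Set.exists_min_image A (fun G => G.edgeSet.ncard) A.toFinite hne
    have hbridge : ∀ e ∈ H.edgeSet, ¬ H.IsBridge e := by
      intro e he hb
      have h1 := hmin _ ((hA H e hb).1 hH)
      rw [edgeSet_deleteEdges] at h1
      exact h1.not_gt (Set.ncard_sdiff_singleton_lt_of_mem he)
    set E := (H.allBridgeExtensions : Set (SimpleGraph (Fin n))) with hE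
    have hsub : E ⊆ A := hA.allBridgeExtensions_subset hH
    have hE_alt : BridgeAlterable E := bridgeAlterable_allBridgeExtensions hbridge
    have hdiff : BridgeAlterable (A \ E) := fun G e he =>
      and_congr (hA G e he) (not_congr (hE_alt G e he))
    have hcard : (A \ E).ncard + E.ncard = A.ncard := Set.ncard_sdiff_add_ncard_of_subset hsub
    have hHE : H ∈ E := by
      rw [hE, Finset.mem_coe, mem_allBridgeExtensions]
      exact ⟨le_rfl, rfl⟩
    have hpos : 0 < E.ncard := (Set.ncard_pos).2 ⟨H, hHE⟩
    have hrest := ih _ (by lia) hdiff rfl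
    have hconn : {G ∈ A | G.Connected}.ncard =
        {G ∈ A \ E | G.Connected}.ncard + (H.bridgeExtensions 1).card := by
      rw [← Set.ncard_coe_finset, ← Set.ncard_union_eq]
      · congr 1
        ext G
        have := @hsub G
        simp only [Set.mem_ofPred_eq, Set.mem_union, Set.mem_sdiff, Finset.mem_coe,
          mem_bridgeExtensions_one_iff, hE] at this ⊢
        tauto
      · rw [Set.disjoint_left]
        intro G hG hG'
        exact hG.1.2 (mem_bridgeExtensions_one_iff.1 hG').1
    have hmain := card_bridgeExtensions_one_mul_le H
    rw [← treeCount_eq, ← forestCount_eq, ← Set.ncard_coe_finset H.allBridgeExtensions] at hmain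
    rw [← hm, ← hcard, hconn, mul_add, add_mul]
    exact add_le_add hrest hmain

theorem connected_prob_ge_min_forest_prob_048 (n : ℕ) (hn : 1 ≤ n)
    (A : Set (SimpleGraph (Fin n))) (hA : A.Nonempty) (halt : BridgeAlterable A) :
    sInf {r : ℝ | ∃ t : ℕ, 0.48 * (n : ℝ) < t ∧ t ≤ n ∧
        r = (treeCount t : ℝ) / (forestCount t : ℝ)}
      ≤ ({G ∈ A | G.Connected}.ncard : ℝ) / (A.ncard : ℝ) := by
  have : NeZero n := ⟨by lia⟩
  have hn0 : (0 : ℝ) < n := by exact_mod_cast hn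
  have hbdd : BddBelow {r : ℝ | ∃ t : ℕ, 0.48 * (n : ℝ) < t ∧ t ≤ n ∧
      r = (treeCount t : ℝ) / (forestCount t : ℝ)} := by
    refine ⟨0, ?_⟩
    rintro r ⟨t, -, -, rfl⟩
    positivity
  refine (csInf_le hbdd ⟨n, by linarith, le_rfl, rfl⟩).trans ?_
  have hF : 0 < forestCount n := by
    rw [forestCount_eq, Finset.card_pos]
    exact ⟨⊥, mem_allBridgeExtensions.2 ⟨le_rfl, rfl⟩⟩
  have hA0 : 0 < A.ncard := (Set.ncard_pos).2 hA
  rw [div_le_div_iff₀ (by exact_mod_cast hF) (by exact_mod_cast hA0)]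
  exact_mod_cast halt.treeCount_mul_ncard_le
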